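/- arXiv:2505.08144 — 11 statements merged into one kernel-verified Lean document; each statement's English description precedes it below -/
import Mathlib

section
/- Fix an integer N ≥ 1. For l ∈ {1,…,N} and r ∈ {1,…,2^{N−l}} define c(r,l) = 2^{l−1}(2r−1) and define finite sets of integers I'_{r,l} recursively by I'_{r,1} = {c(r,1)} and, for 2 ≤ l ≤ N, I'_{r,l} = {c(r,l)} ∪ I'_{2r−1,l−1} ∪ I'_{2r,l−1}. Then for every l ∈ {1,…,N} and every r ∈ {1,…,2^{N−l}}, I'_{r,l} = {m ∈ ℤ : c(r,l) − 2^{l−1} + 1 ≤ m ≤ c(r,l) + 2^{l−1} − 1}, i.e. I'_{r,l} is the set of consecutive integers centered at c(r,l) of radius 2^{l−1} − 1. -/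
/-- The center `c(r,l) = 2^(l-1) * (2r - 1)` as an integer. -/
def dyadCenter (r l : ℕ) : ℤ := 2 ^ (l - 1) * (2 * (r : ℤ) - 1)

/-- The recursively defined sets `I'_{r,l}`:
`I'_{r,1} = {c(r,1)}` and `I'_{r,l} = {c(r,l)} ∪ I'_{2r-1,l-1} ∪ I'_{2r,l-1}` for `l ≥ 2`. -/
def Iprime : ℕ → ℕ → Finset ℤ
  | 0, _ => ∅
  | 1, r => {dyadCenter r 1}
  | (l + 2), r =>
      {dyadCenter r (l + 2)} ∪ Iprime (l + 1) (2 * r - 1) ∪ Iprime (l + 1) (2 * r)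

theorem Iprime_succ_eq_Icc (l r : ℕ) (hr : 1 ≤ r) :
    Iprime (l + 1) r =
      Finset.Icc (dyadCenter r (l + 1) - 2 ^ l + 1) (dyadCenter r (l + 1) + 2 ^ l - 1) := by
  induction l generalizing r with
  | zero => simp [Iprime]
  | succ l ih =>
    have hP : (1 : ℤ) ≤ 2 ^ l := one_le_pow₀ (by norm_num)
    have h_left : dyadCenter (2 * r - 1) (l + 1) = dyadCenter r (l + 2) - 2 ^ l := by
      simp only [dyadCenter, Nat.add_sub_cancel, Nat.add_succ_sub_one]
      push_cast [show 1 ≤ 2 * r by omega]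
      ring
    have h_right : dyadCenter (2 * r) (l + 1) = dyadCenter r (l + 2) + 2 ^ l := by
      simp only [dyadCenter, Nat.add_sub_cancel, Nat.add_succ_sub_one]
      push_cast
      ring
    rw [Iprime, ih _ (by omega), ih _ (by omega), h_left, h_right, pow_succ]
    clear h_left h_right
    generalize (2 : ℤ) ^ l = P at hP
    generalize dyadCenter r (l + 2) = c
    ext m
    simp only [Finset.mem_union, Finset.mem_singleton, Finset.mem_Icc]
    omega

/-- For every `1 ≤ l ≤ N` and `1 ≤ r ≤ 2^(N-l)`, the set `I'_{r,l}` is the set of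
consecutive integers centered at `c(r,l)` of radius `2^(l-1) - 1`. -/
theorem Iprime_eq_Icc (N : ℕ) (hN : 1 ≤ N) (l r : ℕ) (hl1 : 1 ≤ l) (hlN : l ≤ N)
    (hr1 : 1 ≤ r) (hr2 : r ≤ 2 ^ (N - l)) :
    Iprime l r =
      Finset.Icc (dyadCenter r l - 2 ^ (l - 1) + 1) (dyadCenter r l + 2 ^ (l - 1) - 1) := by
  obtain ⟨k, rfl⟩ := Nat.exists_eq_add_of_le' hl1
  exact Iprime_succ_eq_Icc k r hr1
end

section
/- Let N, k ≥ 1 be integers and d = k·(2^N − 1). If A and B are real d×d matrices with A ∈ HD(N,k) and B ∈ HD(N,k), then the matrix product A·B satisfies A·B ∈ HD(N,k); that is, the class of horizontally dyadic matrices is closed under matrix multiplication. -/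
/-- Membership `(p,q) ∈ 𝐈_N`: `1 ≤ p,q ≤ 2^N - 1` and `|q - p| < 2^(ν(p))`,
where `ν(p)` is the 2-adic valuation of `p`. -/
def dyadIdx (N p q : ℕ) : Prop :=
  1 ≤ p ∧ p ≤ 2 ^ N - 1 ∧ 1 ≤ q ∧ q ≤ 2 ^ N - 1 ∧
    |(q : ℤ) - (p : ℤ)| < 2 ^ (padicValNat 2 p)

/-- The block index `⌈i/k⌉` of a 1-based entry index `i`, expressed for the
0-based index `v = i - 1` as `v / k + 1`. -/
def blk (k v : ℕ) : ℕ := v / k + 1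

/-- `A` is horizontally dyadic of height `N` and breadth `k`. -/
def IsHD (N k : ℕ) (A : Matrix (Fin (k * (2 ^ N - 1))) (Fin (k * (2 ^ N - 1))) ℝ) : Prop :=
  ∀ i j, ¬ dyadIdx N (blk k i.val) (blk k j.val) → A i j = 0

/-- `A` is vertically dyadic of height `N` and breadth `k`. -/
def IsVD (N k : ℕ) (A : Matrix (Fin (k * (2 ^ N - 1))) (Fin (k * (2 ^ N - 1))) ℝ) : Prop :=
  ∀ i j, ¬ dyadIdx N (blk k j.val) (blk k i.val) → A i j = 0

/-- `A` is symmetrically dyadic of height `N` and breadth `k`. -/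
def IsSD (N k : ℕ) (A : Matrix (Fin (k * (2 ^ N - 1))) (Fin (k * (2 ^ N - 1))) ℝ) : Prop :=
  ∀ i j, ¬ (dyadIdx N (blk k i.val) (blk k j.val) ∨ dyadIdx N (blk k j.val) (blk k i.val)) →
    A i j = 0

theorem dyadIdx.trans {N p q r : ℕ} (hpq : dyadIdx N p q) (hqr : dyadIdx N q r) :
    dyadIdx N p r := by
  obtain ⟨hp, hpN, -, -, hd⟩ := hpq
  obtain ⟨-, -, hr, hrN, he⟩ := hqr
  refine ⟨hp, hpN, hr, hrN, ?_⟩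
  have hpdvd : (2 : ℤ) ^ padicValNat 2 p ∣ p := by
    exact_mod_cast pow_padicValNat_dvd (p := 2) (n := p)
  have hqdvd : (2 : ℤ) ^ padicValNat 2 q ∣ q := by
    exact_mod_cast pow_padicValNat_dvd (p := 2) (n := q)
  rcases le_total (padicValNat 2 p) (padicValNat 2 q) with h | h
  · have hdvd : (2 : ℤ) ^ padicValNat 2 p ∣ (q : ℤ) - p :=
      dvd_sub ((pow_dvd_pow 2 h).trans hqdvd) hpdvd
    have hzero : (q : ℤ) - p = 0 := Int.eq_zero_of_abs_lt_dvd hdvd hd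
    have heq : q = p := by omega
    rwa [heq] at he
  · have hpow : (2 : ℤ) ^ padicValNat 2 q ∣ 2 ^ padicValNat 2 p := pow_dvd_pow 2 h
    have hdvd : (2 : ℤ) ^ padicValNat 2 q ∣ 2 ^ padicValNat 2 p - |(q : ℤ) - p| :=
      dvd_sub hpow ((dvd_abs _ _).2 (dvd_sub hqdvd (hpow.trans hpdvd)))
    have hle := Int.le_of_dvd (sub_pos.2 hd) hdvd
    have htri := abs_sub_le (r : ℤ) q p
    linarith

/-- The class of horizontally dyadic matrices is closed under matrix multiplication. -/
theorem HD_mul_HD (N k : ℕ) (hN : 1 ≤ N) (hk : 1 ≤ k)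
    (A B : Matrix (Fin (k * (2 ^ N - 1))) (Fin (k * (2 ^ N - 1))) ℝ)
    (hA : IsHD N k A) (hB : IsHD N k B) : IsHD N k (A * B) := by
  intro i j hij
  rw [Matrix.mul_apply]
  refine Finset.sum_eq_zero fun l _ => ?_
  by_cases hil : dyadIdx N (blk k i.val) (blk k l.val)
  · rw [hB l j fun hlj => hij (hil.trans hlj), mul_zero]
  · rw [hA i l hil, zero_mul]
end

section
/- Let N, k ≥ 1 be integers and d = k·(2^N − 1). If A and B are real d×d matrices with A ∈ VD(N,k) and B ∈ VD(N,k), then the matrix product A·B satisfies A·B ∈ VD(N,k); that is, the class of vertically dyadic matrices is closed under matrix multiplication. -/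
/-- The class of vertically dyadic matrices is closed under matrix multiplication. -/
theorem VD_mul_VD (N k : ℕ) (hN : 1 ≤ N) (hk : 1 ≤ k)
    (A B : Matrix (Fin (k * (2 ^ N - 1))) (Fin (k * (2 ^ N - 1))) ℝ)
    (hA : IsVD N k A) (hB : IsVD N k B) : IsVD N k (A * B) := by
  intro i j hij
  rw [Matrix.mul_apply]
  refine Finset.sum_eq_zero fun l _ => ?_
  by_cases hlj : dyadIdx N (blk k j.val) (blk k l.val)
  · rw [hA i l fun hil => hij (hlj.trans hil), zero_mul]
  · rw [hB l j hlj, mul_zero]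
end

section
/- Let N, k ≥ 1 be integers and d = k·(2^N − 1). If A and B are real d×d matrices with A ∈ HD(N,k) and B ∈ VD(N,k), then the matrix product A·B satisfies A·B ∈ SD(N,k); that is, the product of a horizontally dyadic matrix and a vertically dyadic matrix (in that order) is symmetrically dyadic. -/
/-- A positive natural number is an odd multiple of the power of two given by its valuation. -/
theorem exists_eq_two_pow_padicValNat_mul_odd {p : ℕ} (hp : 1 ≤ p) :
    ∃ m : ℤ, (p : ℤ) = 2 ^ padicValNat 2 p * (2 * m + 1) := by
  obtain ⟨u, hu⟩ := pow_padicValNat_dvd (p := 2) (n := p)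
  have hodd : ¬ 2 ∣ u := by
    rintro ⟨v, rfl⟩
    exact pow_succ_padicValNat_not_dvd (p := 2) (by omega : p ≠ 0)
      ⟨v, by rw [pow_succ, mul_assoc, ← hu]⟩
  refine ⟨(u / 2 : ℕ), ?_⟩
  have h : u = 2 * (u / 2) + 1 := by omega
  calc (p : ℤ) = ((2 ^ padicValNat 2 p * u : ℕ) : ℤ) := by rw [← hu]
    _ = ((2 ^ padicValNat 2 p * (2 * (u / 2) + 1) : ℕ) : ℤ) := by rw [← h]
    _ = _ := by push_cast; rfl

/-- If the open intervals of radius `M` and `M * C` around an odd multiple of `M` and an odd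
multiple of `M * C` meet, then the larger one contains the center of the smaller one. -/
theorem abs_sub_lt_of_odd_multiples {M C m n r : ℤ} (hM : 0 < M)
    (h₁ : |r - M * (2 * m + 1)| < M) (h₂ : |r - M * C * (2 * n + 1)| < M * C) :
    |M * (2 * m + 1) - M * C * (2 * n + 1)| < M * C := by
  rw [abs_lt] at *
  constructor
  · by_contra! h
    have hle : 2 * m + 1 ≤ 2 * (C * n) := by
      refine le_of_mul_le_mul_left ?_ hM
      linarith
    have hlt : 2 * m + 2 ≤ 2 * (C * n) := by omega
    have := mul_le_mul_of_nonneg_left hlt hM.le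
    linarith
  · by_contra! h
    have hle : 2 * (C * (n + 1)) ≤ 2 * m + 1 := by
      refine le_of_mul_le_mul_left ?_ hM
      linarith
    have hlt : 2 * (C * (n + 1)) ≤ 2 * m := by omega
    have := mul_le_mul_of_nonneg_left hlt hM.le
    linarith

theorem dyadIdx_of_common_of_le {N p q r : ℕ} (hp : dyadIdx N p r) (hq : dyadIdx N q r)
    (hle : padicValNat 2 p ≤ padicValNat 2 q) : dyadIdx N q p := by
  obtain ⟨hp₁, hp₂, -, -, hpr⟩ := hp
  obtain ⟨hq₁, hq₂, -, -, hqr⟩ := hq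
  refine ⟨hq₁, hq₂, hp₁, hp₂, ?_⟩
  obtain ⟨m, hm⟩ := exists_eq_two_pow_padicValNat_mul_odd hp₁
  obtain ⟨n, hn⟩ := exists_eq_two_pow_padicValNat_mul_odd hq₁
  obtain ⟨c, hc⟩ := Nat.exists_eq_add_of_le hle
  rw [hc, pow_add] at hn hqr ⊢
  rw [hm] at hpr ⊢
  rw [hn] at hqr ⊢
  exact abs_sub_lt_of_odd_multiples (by positivity) hpr hqr

theorem dyadIdx_or_dyadIdx_of_common {N p q r : ℕ} (hp : dyadIdx N p r) (hq : dyadIdx N q r) :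
    dyadIdx N p q ∨ dyadIdx N q p :=
  (le_total (padicValNat 2 p) (padicValNat 2 q)).elim
    (fun h => .inr (dyadIdx_of_common_of_le hp hq h))
    (fun h => .inl (dyadIdx_of_common_of_le hq hp h))

/-- The product of a horizontally dyadic matrix and a vertically dyadic matrix
(in that order) is symmetrically dyadic. -/
theorem HD_mul_VD (N k : ℕ) (hN : 1 ≤ N) (hk : 1 ≤ k)
    (A B : Matrix (Fin (k * (2 ^ N - 1))) (Fin (k * (2 ^ N - 1))) ℝ)
    (hA : IsHD N k A) (hB : IsVD N k B) : IsSD N k (A * B) := by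
  intro i j hij
  rw [Matrix.mul_apply]
  refine Finset.sum_eq_zero fun l _ => ?_
  by_cases hil : dyadIdx N (blk k i.val) (blk k l.val)
  · rw [hB l j fun hjl => hij (dyadIdx_or_dyadIdx_of_common hil hjl), mul_zero]
  · rw [hA i l hil, zero_mul]
end

section
/- Let N, k ≥ 1 be integers and d = k·(2^N − 1). For real d×d matrices, if A ∈ HD(N,k) and S ∈ SD(N,k) then A·S ∈ SD(N,k), and if S ∈ SD(N,k) and B ∈ VD(N,k) then S·B ∈ SD(N,k). -/
/-- A number strictly below another multiple of `t` is at distance at least `t` from it. -/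
theorem add_le_of_dvd_of_lt {t x y : ℤ} (hx : t ∣ x) (hy : t ∣ y) (h : x < y) : x + t ≤ y := by
  have := Int.le_of_dvd (sub_pos.mpr h) (dvd_sub hy hx)
  linarith

theorem two_pow_padicValNat_dvd_intCast (p : ℕ) : (2 : ℤ) ^ padicValNat 2 p ∣ p := by
  exact_mod_cast (pow_padicValNat_dvd : 2 ^ padicValNat 2 p ∣ p)

/-- If the dyadic intervals around `p` and `r` meet in `q`, the one of higher level contains
the centre of the other. -/
theorem dyadIdx.of_common_right {N p q r : ℕ} (hpq : dyadIdx N p q) (hrq : dyadIdx N r q)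
    (hle : padicValNat 2 p ≤ padicValNat 2 r) : dyadIdx N r p := by
  obtain ⟨hp, hp', -, -, h⟩ := hpq
  obtain ⟨hr, hr', -, -, h'⟩ := hrq
  refine ⟨hr, hr', hp, hp', ?_⟩
  have hpow := pow_dvd_pow (2 : ℤ) hle
  have hd : (2 : ℤ) ^ padicValNat 2 p ∣ |(p : ℤ) - r| := (dvd_abs _ _).mpr <|
    dvd_sub (two_pow_padicValNat_dvd_intCast p)
      (hpow.trans (two_pow_padicValNat_dvd_intCast r))
  by_contra! hge
  have heq : |(p : ℤ) - r| = 2 ^ padicValNat 2 r := by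
    refine le_antisymm ?_ hge
    by_contra! hgt
    have := add_le_of_dvd_of_lt hpow hd hgt
    have := abs_sub_le (p : ℤ) q r
    rw [abs_sub_comm (p : ℤ) q] at this
    linarith
  obtain ⟨m, hm⟩ := exists_eq_two_pow_padicValNat_mul_odd hp
  obtain ⟨n, hn⟩ := exists_eq_two_pow_padicValNat_mul_odd hr
  obtain ⟨c, hc⟩ := hpow
  have hne : (2 : ℤ) ^ padicValNat 2 p ≠ 0 := by positivity
  obtain ⟨t, ht⟩ : ∃ t : ℤ, (p : ℤ) = 2 ^ padicValNat 2 r * (2 * t) := by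
    rcases (abs_eq (by positivity)).mp heq with h₁ | h₁
    · exact ⟨n + 1, by linear_combination h₁ + hn⟩
    · exact ⟨n, by linear_combination h₁ + hn⟩
  have : 2 * m + 1 = 2 * (c * t) := by
    apply mul_left_cancel₀ hne
    linear_combination ht - hm + 2 * t * hc
  omega

/-- An index comparable with a descendant of `p` is comparable with `p`. -/
theorem dyadIdx.comparable_of_comparable {N p q r : ℕ} (hpq : dyadIdx N p q)
    (hqr : dyadIdx N q r ∨ dyadIdx N r q) : dyadIdx N p r ∨ dyadIdx N r p := by
  rcases hqr with hqr | hrq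
  · exact Or.inl (hpq.trans hqr)
  · exact (le_total (padicValNat 2 p) (padicValNat 2 r)).symm.imp
      (hrq.of_common_right hpq) (hpq.of_common_right hrq)

/-- `HD · SD ⊆ SD` and `SD · VD ⊆ SD`. -/
theorem HD_mul_SD_and_SD_mul_VD (N k : ℕ) (hN : 1 ≤ N) (hk : 1 ≤ k) :
    (∀ A S : Matrix (Fin (k * (2 ^ N - 1))) (Fin (k * (2 ^ N - 1))) ℝ,
      IsHD N k A → IsSD N k S → IsSD N k (A * S)) ∧
    (∀ S B : Matrix (Fin (k * (2 ^ N - 1))) (Fin (k * (2 ^ N - 1))) ℝ,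
      IsSD N k S → IsVD N k B → IsSD N k (S * B)) := by
  refine ⟨fun A S hA hS i l hil => ?_, fun S B hS hB i l hil => ?_⟩
  · rw [Matrix.mul_apply]
    refine Finset.sum_eq_zero fun j _ => ?_
    by_cases hij : dyadIdx N (blk k i.val) (blk k j.val)
    · rw [hS j l fun hjl => hil (hij.comparable_of_comparable hjl), mul_zero]
    · rw [hA i j hij, zero_mul]
  · rw [Matrix.mul_apply]
    refine Finset.sum_eq_zero fun j _ => ?_
    by_cases hlj : dyadIdx N (blk k l.val) (blk k j.val)
    · rw [hS i j fun hij => hil (hlj.comparable_of_comparable hij.symm).symm, zero_mul]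
    · rw [hB j l hlj, mul_zero]
end

section
/- Let N, k ≥ 1 be integers, d = k·(2^N − 1), and let Σ be a real symmetric positive definite d×d matrix with Σ ∈ SD(N,k). Then there exists an invertible real d×d matrix P with P ∈ VD(N,k) such that P^⊤ Σ P = I_d (the d×d identity matrix), the inverse R = P^{−1} also satisfies R ∈ VD(N,k), and moreover P^{−1} = P^⊤ Σ. -/
namespace DyadicFactorization

open Matrix

section Support

variable {ι : Type*} [Fintype ι] [DecidableEq ι]

/-- A vector with `c j = 1`, supported on `D ∪ {j}`, which is `S`-orthogonal to the coordinate
vectors indexed by `D`. -/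
lemma exists_orthogonal_to_coordinates {S : Matrix ι ι ℝ} (hS : S.PosDef) (D : ι → Prop) (j : ι)
    (hj : ¬ D j) :
    ∃ c : ι → ℝ, c j = 1 ∧ (∀ i, c i ≠ 0 → D i ∨ i = j) ∧ ∀ i, D i → (S *ᵥ c) i = 0 := by
  classical
  set T : Matrix {i // D i} {i // D i} ℝ := S.submatrix Subtype.val Subtype.val with hT
  have hTpos : T.PosDef := hS.submatrix Subtype.val_injective
  have hdet : IsUnit T.det := (Matrix.isUnit_iff_isUnit_det T).1 hTpos.isUnit
  set x : {i // D i} → ℝ := T⁻¹ *ᵥ fun i => S i j with hx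
  have hTx : T *ᵥ x = fun i : {i // D i} => S i j := by
    rw [hx, Matrix.mulVec_mulVec, Matrix.mul_nonsing_inv _ hdet, Matrix.one_mulVec]
  set y : ι → ℝ := fun i => if h : D i then x ⟨i, h⟩ else 0 with hy
  refine ⟨Pi.single j 1 - y, by simp [hy, hj], ?_, ?_⟩
  · intro i hi
    by_contra! h
    exact hi (by simp [hy, h.1, h.2])
  · intro i hi
    have h1 : (S *ᵥ y) i = (T *ᵥ x) ⟨i, hi⟩ := by
      simp only [Matrix.mulVec, dotProduct]
      rw [← Fintype.sum_subtype_add_sum_subtype D fun l => S i l * y l]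
      have hzero : ∑ l : {l // ¬ D l}, S i l * y l = 0 :=
        Finset.sum_eq_zero fun l _ => by simp [hy, l.2]
      rw [hzero, add_zero]
      exact Finset.sum_congr rfl fun l _ => by simp [hy, hT, l.2]
    rw [Matrix.mulVec_sub, Pi.sub_apply, h1, hTx]
    simp

/-- Matrices supported on a transitive reflexive relation are closed under inversion. -/
lemma inv_supported {r : ι → ι → Prop} (hrefl : ∀ i, r i i)
    (htrans : ∀ i j l, r i j → r j l → r i l) {P : Matrix ι ι ℝ} (hP : IsUnit P)
    (hsupp : ∀ i j, ¬ r i j → P i j = 0) (i j : ι) (hij : ¬ r i j) : P⁻¹ i j = 0 := by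
  classical
  have hb : P.BlockTriangular fun l => decide (¬ r l j) := by
    intro a b hab
    simp only [Bool.lt_iff, decide_eq_false_iff_not, not_not, decide_eq_true_eq] at hab
    exact hsupp a b fun h => hab.2 (htrans _ _ _ h hab.1)
  have := hP.invertible
  refine Matrix.blockTriangular_inv_of_blockTriangular hb ?_
  simp [Bool.lt_iff, hrefl, hij]

/-- If the support of a positive definite matrix consists of pairs comparable for a forest-like
preorder `r`, then the matrix has an orthonormalizing basis whose `j`-th vector is supported on
the elements below `j`. -/
lemma exists_orthonormalizing_of_forest {α : Type*} [LinearOrder α] {S : Matrix ι ι ℝ}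
    (hS : S.PosDef) {r : ι → ι → Prop} (hrefl : ∀ i, r i i)
    (htrans : ∀ i j l, r i j → r j l → r i l)
    (hforest : ∀ x i j, r x i → r x j → r i j ∨ r j i)
    (f : ι → α) (hf : Function.Injective f) (hmono : ∀ i j, r i j → f j < f i → r j i)
    (hsupp : ∀ i j, ¬ (r i j ∨ r j i) → S i j = 0) :
    ∃ P : Matrix ι ι ℝ, (∀ i j, ¬ r i j → P i j = 0) ∧ Pᵀ * S * P = 1 := by
  have hex := fun j => exists_orthogonal_to_coordinates hS (fun i => r i j ∧ f i < f j) j (by simp)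
  choose c hcj hcsupp hcorth using hex
  have hcr : ∀ i j, c j i ≠ 0 → r i j := fun i j h => by
    rcases hcsupp j i h with h | rfl
    exacts [h.1, hrefl _]
  have horth : ∀ l j, f l < f j → c l ⬝ᵥ (S *ᵥ c j) = 0 := by
    intro l j hlt
    by_cases hlj : r l j
    · refine Finset.sum_eq_zero fun i _ => ?_
      by_cases hi : c l i = 0
      · simp [hi]
      · rw [hcorth j i, mul_zero]
        refine ⟨htrans _ _ _ (hcr i l hi) hlj, ?_⟩
        rcases hcsupp l i hi with h | rfl
        exacts [h.2.trans hlt, hlt]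
    · have hjl : ¬ r j l := fun h => hlj (hmono _ _ h hlt)
      refine Finset.sum_eq_zero fun x _ => ?_
      by_cases hx : c l x = 0
      · simp [hx]
      · refine mul_eq_zero_of_right _ (Finset.sum_eq_zero fun y _ => ?_)
        by_cases hy : c j y = 0
        · simp [hy]
        · have hxl := hcr _ _ hx
          have hyj := hcr _ _ hy
          refine mul_eq_zero_of_left (hsupp x y ?_) _
          rintro (h | h)
          · exact (hforest x l j hxl (htrans _ _ _ h hyj)).elim hlj hjl
          · exact (hforest y l j (htrans _ _ _ h hxl) hyj).elim hlj hjl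
  have hsymm : ∀ u v : ι → ℝ, u ⬝ᵥ (S *ᵥ v) = v ⬝ᵥ (S *ᵥ u) := by
    intro u v
    have hST : Sᵀ = S := by simpa using hS.isHermitian.eq
    rw [Matrix.dotProduct_mulVec, dotProduct_comm, ← Matrix.mulVec_transpose, hST]
  have horth_ne : ∀ l j, l ≠ j → c l ⬝ᵥ (S *ᵥ c j) = 0 := by
    intro l j hne
    rcases lt_or_gt_of_ne (hf.ne hne) with h | h
    · exact horth l j h
    · rw [hsymm]
      exact horth j l h
  have hpos : ∀ j, 0 < c j ⬝ᵥ (S *ᵥ c j) := by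
    intro j
    have hne : c j ≠ 0 := fun h => by simpa [h] using hcj j
    simpa using hS.dotProduct_mulVec_pos hne
  set s : ι → ℝ := fun j => Real.sqrt (c j ⬝ᵥ (S *ᵥ c j)) with hs
  have hs0 : ∀ j, s j ≠ 0 := fun j => (Real.sqrt_pos.2 (hpos j)).ne'
  have hss : ∀ j, c j ⬝ᵥ (S *ᵥ c j) = s j * s j := fun j => (Real.mul_self_sqrt (hpos j).le).symm
  refine ⟨Matrix.of fun i j => (s j)⁻¹ * c j i, ?_, ?_⟩
  · intro i j h
    have : c j i = 0 := by
      by_contra hne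
      exact h (hcr _ _ hne)
    simp [this]
  · ext l j
    have hentry : ((Matrix.of fun i j => (s j)⁻¹ * c j i)ᵀ * S *
        (Matrix.of fun i j => (s j)⁻¹ * c j i) : Matrix ι ι ℝ) l j =
        ((s l)⁻¹ • c l) ⬝ᵥ (S *ᵥ ((s j)⁻¹ • c j)) := by
      rw [Matrix.mul_assoc]
      rfl
    rw [hentry, Matrix.mulVec_smul, smul_dotProduct, dotProduct_smul]
    rcases eq_or_ne l j with rfl | hne
    · rw [hss, Matrix.one_apply_eq, smul_eq_mul, smul_eq_mul]
      field_simp [hs0 l]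
    · simp [horth_ne l j hne, hne]

end Support

section Tree

lemma exists_eq_two_pow_mul_odd {p : ℕ} (hp : 1 ≤ p) :
    ∃ m : ℤ, (p : ℤ) = 2 ^ padicValNat 2 p * (2 * m + 1) := by
  obtain ⟨c, hc⟩ := pow_padicValNat_dvd (p := 2) (n := p)
  have hodd : ¬ 2 ∣ c := by
    rintro ⟨t, rfl⟩
    refine pow_succ_padicValNat_not_dvd (p := 2) (n := p) (by omega) ⟨t, ?_⟩
    rw [pow_succ, mul_assoc]
    exact hc
  obtain ⟨m, rfl⟩ : ∃ m, c = 2 * m + 1 := ⟨c / 2, by omega⟩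
  exact ⟨m, by exact_mod_cast hc⟩

lemma dyadIdx_refl {N p : ℕ} (h1 : 1 ≤ p) (h2 : p ≤ 2 ^ N - 1) : dyadIdx N p p :=
  ⟨h1, h2, h1, h2, by simp⟩

lemma eq_of_dyadIdx_of_valuation_le {N p q : ℕ} (h : dyadIdx N p q)
    (hv : padicValNat 2 p ≤ padicValNat 2 q) : q = p := by
  obtain ⟨hp, -, hq, -, hlt⟩ := h
  have hdp : (2 : ℤ) ^ padicValNat 2 p ∣ p := by
    exact_mod_cast pow_padicValNat_dvd (p := 2) (n := p)
  have hdq : (2 : ℤ) ^ padicValNat 2 p ∣ q :=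
    (pow_dvd_pow _ hv).trans (by exact_mod_cast pow_padicValNat_dvd (p := 2) (n := q))
  have := Int.eq_zero_of_abs_lt_dvd (dvd_sub hdq hdp) hlt
  omega

lemma dyadIdx_trans {N p q s : ℕ} (h : dyadIdx N p q) (h' : dyadIdx N q s) : dyadIdx N p s := by
  rcases le_total (padicValNat 2 p) (padicValNat 2 q) with hv | hv
  · rwa [← eq_of_dyadIdx_of_valuation_le h hv]
  · obtain ⟨hp, hp', hq, -, hlt⟩ := h
    obtain ⟨-, -, hs, hs', hlt'⟩ := h'
    refine ⟨hp, hp', hs, hs', ?_⟩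
    have hdq : (2 : ℤ) ^ padicValNat 2 q ∣ q := by
      exact_mod_cast pow_padicValNat_dvd (p := 2) (n := q)
    have hde : (2 : ℤ) ^ padicValNat 2 q ∣ 2 ^ padicValNat 2 p := pow_dvd_pow _ hv
    have hdp : (2 : ℤ) ^ padicValNat 2 q ∣ p :=
      hde.trans (by exact_mod_cast pow_padicValNat_dvd (p := 2) (n := p))
    rw [abs_lt] at *
    have h1 := Int.le_of_dvd (by linarith) (dvd_sub hde (dvd_sub hdq hdp))
    have h2 := Int.le_of_dvd (by linarith) (dvd_add hde (dvd_sub hdq hdp))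
    constructor <;> linarith

lemma dyadIdx_of_common_of_valuation_le {N p q x : ℕ} (h : dyadIdx N p x) (h' : dyadIdx N q x)
    (hv : padicValNat 2 p ≤ padicValNat 2 q) : dyadIdx N q p := by
  obtain ⟨hp, hp', -, -, hlt⟩ := h
  obtain ⟨hq, hq', -, -, hlt'⟩ := h'
  refine ⟨hq, hq', hp, hp', ?_⟩
  obtain ⟨m, hm⟩ := exists_eq_two_pow_mul_odd hq
  have hde : (2 : ℤ) ^ padicValNat 2 p ∣ 2 ^ padicValNat 2 q := pow_dvd_pow _ hv
  have hdq : (2 : ℤ) ^ padicValNat 2 p ∣ q :=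
    hde.trans (by exact_mod_cast pow_padicValNat_dvd (p := 2) (n := q))
  have hdp : (2 : ℤ) ^ padicValNat 2 p ∣ p := by
    exact_mod_cast pow_padicValNat_dvd (p := 2) (n := p)
  have hnd : ¬ (2 : ℤ) ^ (padicValNat 2 q + 1) ∣ p := by
    intro hd
    have hd' : 2 ^ (padicValNat 2 q + 1) ∣ p := by exact_mod_cast hd
    exact pow_succ_padicValNat_not_dvd (p := 2) (n := p) (by omega)
      ((pow_dvd_pow 2 (by omega)).trans hd')
  have hne1 : (p : ℤ) ≠ q - 2 ^ padicValNat 2 q := fun he =>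
    hnd ⟨m, by rw [he, pow_succ]; linear_combination hm⟩
  have hne2 : (p : ℤ) ≠ q + 2 ^ padicValNat 2 q := fun he =>
    hnd ⟨m + 1, by rw [he, pow_succ]; linear_combination hm⟩
  rw [abs_lt] at *
  constructor
  · by_contra! hle
    have hlt1 : 0 < (q : ℤ) - 2 ^ padicValNat 2 q - p := by omega
    have := Int.le_of_dvd hlt1 (dvd_sub (dvd_sub hdq hde) hdp)
    linarith
  · by_contra! hle
    have hlt1 : 0 < (p : ℤ) - (q + 2 ^ padicValNat 2 q) := by omega
    have := Int.le_of_dvd hlt1 (dvd_sub hdp (dvd_add hdq hde))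
    linarith

lemma dyadIdx_comparable {N p q x : ℕ} (h : dyadIdx N p x) (h' : dyadIdx N q x) :
    dyadIdx N q p ∨ dyadIdx N p q :=
  (le_total (padicValNat 2 p) (padicValNat 2 q)).imp
    (dyadIdx_of_common_of_valuation_le h h') (dyadIdx_of_common_of_valuation_le h' h)

lemma blk_le {k v M : ℕ} (hv : v < k * M) : blk k v ≤ M :=
  Nat.div_lt_of_lt_mul hv

end Tree

end DyadicFactorization

/-- For a symmetric positive definite symmetrically dyadic matrix `Σ` there is an
invertible vertically dyadic `P` with `Pᵀ Σ P = I`, whose inverse `R = P⁻¹` is also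
vertically dyadic and satisfies `P⁻¹ = Pᵀ Σ`. -/
theorem dyadic_factorization (N k : ℕ) (hN : 1 ≤ N) (hk : 1 ≤ k)
    (Sig : Matrix (Fin (k * (2 ^ N - 1))) (Fin (k * (2 ^ N - 1))) ℝ)
    (hPD : Sig.PosDef) (hSD : IsSD N k Sig) :
    ∃ P : Matrix (Fin (k * (2 ^ N - 1))) (Fin (k * (2 ^ N - 1))) ℝ,
      IsUnit P ∧ IsVD N k P ∧ P.transpose * Sig * P = 1 ∧
      IsVD N k P⁻¹ ∧ P⁻¹ = P.transpose * Sig := by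
  classical
  set r : Fin (k * (2 ^ N - 1)) → Fin (k * (2 ^ N - 1)) → Prop :=
    fun i j => dyadIdx N (blk k j.val) (blk k i.val) with hr
  have hrefl : ∀ i, r i i := fun i =>
    DyadicFactorization.dyadIdx_refl (Nat.succ_pos _) (DyadicFactorization.blk_le i.2)
  have htrans : ∀ i j l, r i j → r j l → r i l := fun i j l h h' =>
    DyadicFactorization.dyadIdx_trans h' h
  obtain ⟨P, hPsupp, hP⟩ := DyadicFactorization.exists_orthonormalizing_of_forest hPD hrefl htrans
    (fun x i j h h' => DyadicFactorization.dyadIdx_comparable h h')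
    (fun i => toLex (padicValNat 2 (blk k i.val), i))
    (fun i j h => (Prod.ext_iff.1 (toLex.injective h)).2)
    (fun i j h hlt => by
      have hv : padicValNat 2 (blk k j.val) ≤ padicValNat 2 (blk k i.val) :=
        (Prod.Lex.toLex_lt_toLex'.1 hlt).1
      have he : blk k i.val = blk k j.val :=
        DyadicFactorization.eq_of_dyadIdx_of_valuation_le h hv
      simpa only [hr, he] using h)
    (fun i j h => hSD i j fun h' => h h'.symm)
  have hunit : IsUnit P := IsUnit.of_mul_eq_one_right _ hP
  exact ⟨P, hunit, hPsupp, hP, DyadicFactorization.inv_supported hrefl htrans hunit hPsupp,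
    Matrix.inv_eq_left_inv hP⟩
end

section
/- Let N, k ≥ 1 be integers, d = k·(2^N − 1), and let Σ be a real symmetric positive definite d×d matrix with Σ ∈ SD(N,k). Then there exists a real d×d matrix R with R ∈ VD(N,k) such that Σ = R^⊤ R, and there exists a real d×d matrix P with P ∈ VD(N,k) such that Σ^{−1} = P·P^⊤. -/
open Matrix in
/-- Subtracting from a positive semidefinite matrix the rank one matrix built from one of its
rows (a Schur complement step) leaves a positive semidefinite matrix. -/
theorem Matrix.PosSemidef.sub_vecMulVec_row {ι : Type*} [Fintype ι] [DecidableEq ι]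
    {M : Matrix ι ι ℝ} (hM : M.PosSemidef) (i : ι) :
    (M - (M i i)⁻¹ • vecMulVec (M i) (M i)).PosSemidef := by
  by_cases hs : M i i = 0
  · simpa [hs] using hM
  have hsymm : ∀ a b, M a b = M b a := fun a b => by
    simpa using (hM.isHermitian.apply a b).symm
  have hcol : M *ᵥ Pi.single i 1 = M i := by
    ext a
    simp [hsymm a i]
  have hrow : Pi.single i 1 ᵥ* M = M i := by
    ext a
    simp
  have hps := hM.conjTranspose_mul_mul_same
    (1 - (M i i)⁻¹ • vecMulVec (Pi.single i (1 : ℝ)) (M i))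
  convert hps using 1
  ext a b
  simp only [conjTranspose_eq_transpose_of_trivial, transpose_sub, transpose_smul, transpose_one,
    transpose_vecMulVec, sub_mul, mul_sub, one_mul, mul_one, Matrix.smul_mul, Matrix.mul_smul,
    smul_mulVec, vecMulVec_mulVec, dotProduct_single, op_smul_eq_smul, Pi.smul_apply,
    mul_vecMulVec, vecMulVec_mul, hcol, hrow, sub_apply, smul_apply, vecMulVec_apply,
    smul_eq_mul]
  field_simp
  ring

open Matrix in
theorem Matrix.PosSemidef.apply_eq_zero_of_diag_eq_zero {ι : Type*} [Fintype ι] [DecidableEq ι]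
    {M : Matrix ι ι ℝ} (hM : M.PosSemidef) {i : ι} (hi : M i i = 0) (j : ι) : M j i = 0 := by
  have h := (hM.dotProduct_mulVec_zero_iff (Pi.single i 1)).1 (by simp [hi])
  simpa using congrFun h j

/-- Cholesky factorization without fill-in along a preorder in which the upper bounds of any
element form a chain. -/
theorem Matrix.PosSemidef.exists_sum_mul_of_comparable {ι : Type*} [Fintype ι] [DecidableEq ι]
    [Preorder ι] (hchain : ∀ a b c : ι, a ≤ b → a ≤ c → b ≤ c ∨ c ≤ b) (S : Finset ι) :
    ∀ M : Matrix ι ι ℝ, M.PosSemidef →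
      (∀ a b, M a b ≠ 0 → a ∈ S ∧ b ∈ S ∧ (a ≤ b ∨ b ≤ a)) →
      ∃ R : Matrix ι ι ℝ, (∀ a b, R a b ≠ 0 → a ≤ b) ∧
        ∀ a b, M a b = ∑ l ∈ S, R l a * R l b := by
  induction S using Finset.strongInduction with
  | H S ih =>
  intro M hM hsupp
  rcases S.eq_empty_or_nonempty with rfl | hne
  · refine ⟨0, by simp, fun a b => ?_⟩
    by_contra h
    simpa using (hsupp a b (by simpa using h)).1
  obtain ⟨i, hi⟩ := S.exists_minimal hne
  have hsymm : ∀ a b, M a b = M b a := fun a b => by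
    simpa using (hM.isHermitian.apply a b).symm
  have hrow : ∀ a, M i a ≠ 0 → i ≤ a := fun a ha => by
    obtain ⟨-, haS, h | h⟩ := hsupp i a ha
    · exact h
    · exact hi.2 haS h
  have hs : 0 ≤ M i i := hM.diag_nonneg
  have hentry : ∀ a b, (M - (M i i)⁻¹ • vecMulVec (M i) (M i)) a b
      = M a b - (M i i)⁻¹ * (M i a * M i b) := fun a b => by
    simp [vecMulVec_apply]
  have hzero : ∀ a, M i a - (M i i)⁻¹ * (M i i * M i a) = 0 := fun a => by
    by_cases h : M i i = 0
    · simp [h, hsymm i a, hM.apply_eq_zero_of_diag_eq_zero h a]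
    · field_simp
      ring
  obtain ⟨R, hR, hsum⟩ := ih (S.erase i) (Finset.erase_ssubset hi.1) _
    (hM.sub_vecMulVec_row i) (by
      intro a b hab
      rw [hentry] at hab
      have hai : a ≠ i := by
        rintro rfl
        exact hab (hzero b)
      have hbi : b ≠ i := by
        rintro rfl
        apply hab
        rw [hsymm a b, mul_comm (M b a), hzero]
      by_cases h : M a b = 0
      · rw [h] at hab
        have ha : M i a ≠ 0 := by
          intro h0
          simp [h0] at hab
        have hb : M i b ≠ 0 := by
          intro h0
          simp [h0] at hab
        exact ⟨Finset.mem_erase.2 ⟨hai, (hsupp i a ha).2.1⟩,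
          Finset.mem_erase.2 ⟨hbi, (hsupp i b hb).2.1⟩, hchain i a b (hrow a ha) (hrow b hb)⟩
      · obtain ⟨ha, hb, hc⟩ := hsupp a b h
        exact ⟨Finset.mem_erase.2 ⟨hai, ha⟩, Finset.mem_erase.2 ⟨hbi, hb⟩, hc⟩)
  refine ⟨R.updateRow i (fun a => M i a / √(M i i)), fun a b hab => ?_, fun a b => ?_⟩
  · by_cases hai : a = i
    · subst hai
      apply hrow
      intro h0
      simp [h0] at hab
    · rw [Matrix.updateRow_ne hai] at hab
      exact hR a b hab
  · rw [← Finset.add_sum_erase _ _ hi.1, Matrix.updateRow_self]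
    have : ∑ l ∈ S.erase i, R.updateRow i (fun a => M i a / √(M i i)) l a *
        R.updateRow i (fun a => M i a / √(M i i)) l b
        = ∑ l ∈ S.erase i, R l a * R l b :=
      Finset.sum_congr rfl fun l hl => by
        rw [Matrix.updateRow_ne (Finset.ne_of_mem_erase hl)]
    rw [this, ← hsum, hentry, div_mul_div_comm, Real.mul_self_sqrt hs]
    ring

/-- The inverse of a matrix in the incidence algebra of a preorder is again in it. -/
theorem Matrix.inv_apply_eq_zero_of_not_le {ι : Type*} [Fintype ι] [DecidableEq ι] [Preorder ι]
    {R : Matrix ι ι ℝ} (hR : ∀ a b, ¬ a ≤ b → R a b = 0) (hdet : IsUnit R.det) (a b : ι)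
    (hab : ¬ a ≤ b) : R⁻¹ a b = 0 := by
  let V : Submodule ℝ (Matrix ι ι ℝ) :=
    { carrier := {X | ∀ a b, ¬ a ≤ b → X a b = 0}
      add_mem' := fun {X Y} hX hY a b h => by simp [hX a b h, hY a b h]
      zero_mem' := fun a b _ => rfl
      smul_mem' := fun c X hX a b h => by simp [hX a b h] }
  have hmul : ∀ X ∈ V, LinearMap.mulLeft ℝ R X ∈ V := fun X hX a b h => by
    rw [LinearMap.mulLeft_apply, Matrix.mul_apply]
    refine Finset.sum_eq_zero fun l _ => ?_
    by_cases hal : a ≤ l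
    · rw [hX l b fun hlb => h (hal.trans hlb), mul_zero]
    · rw [hR a l hal, zero_mul]
  have hinj : Function.Injective ((LinearMap.mulLeft ℝ R).restrict hmul) := by
    intro X Y h
    have h' : R * X.1 = R * Y.1 := congrArg Subtype.val h
    apply Subtype.ext
    simpa [Matrix.nonsing_inv_mul_cancel_left _ _ hdet] using congrArg (R⁻¹ * ·) h'
  have hone : (1 : Matrix ι ι ℝ) ∈ V := fun a b h =>
    Matrix.one_apply_ne fun e => h e.le
  obtain ⟨X, hX⟩ := LinearMap.injective_iff_surjective.1 hinj ⟨1, hone⟩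
  have hX' : R * X.1 = 1 := congrArg Subtype.val hX
  rw [Matrix.inv_eq_right_inv hX']
  exact X.2 a b hab

theorem Matrix.PosDef.exists_comparable_factorization {ι : Type*} [Fintype ι] [DecidableEq ι]
    [Preorder ι] (hchain : ∀ a b c : ι, a ≤ b → a ≤ c → b ≤ c ∨ c ≤ b)
    {M : Matrix ι ι ℝ} (hM : M.PosDef) (hsupp : ∀ a b, ¬ (a ≤ b ∨ b ≤ a) → M a b = 0) :
    (∃ R : Matrix ι ι ℝ, (∀ a b, ¬ a ≤ b → R a b = 0) ∧ M = R.transpose * R) ∧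
    (∃ P : Matrix ι ι ℝ, (∀ a b, ¬ a ≤ b → P a b = 0) ∧ M⁻¹ = P * P.transpose) := by
  obtain ⟨R, hR, hsum⟩ := Matrix.PosSemidef.exists_sum_mul_of_comparable hchain Finset.univ M
    hM.posSemidef (fun a b h => ⟨Finset.mem_univ _, Finset.mem_univ _, by
      by_contra hc
      exact h (hsupp a b hc)⟩)
  have hR' : ∀ a b, ¬ a ≤ b → R a b = 0 := fun a b h => by
    by_contra hc
    exact h (hR a b hc)
  have hfac : M = R.transpose * R := by
    ext a b
    simp [hsum a b, Matrix.mul_apply]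
  have hdet : IsUnit R.det := by
    have h := hM.det_pos.ne'
    rw [hfac, Matrix.det_mul] at h
    exact (right_ne_zero_of_mul h).isUnit
  refine ⟨⟨R, hR', hfac⟩, R⁻¹, fun a b => Matrix.inv_apply_eq_zero_of_not_le hR' hdet a b, ?_⟩
  rw [hfac, Matrix.mul_inv_rev, Matrix.transpose_nonsing_inv]

theorem two_pow_succ_padicValNat_not_dvd_intCast {p : ℕ} (hp : p ≠ 0) :
    ¬ (2 : ℤ) ^ (padicValNat 2 p + 1) ∣ p := by
  exact_mod_cast pow_succ_padicValNat_not_dvd (p := 2) hp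

theorem two_pow_succ_padicValNat_dvd_add {p : ℕ} (hp : p ≠ 0) :
    (2 : ℤ) ^ (padicValNat 2 p + 1) ∣ p + 2 ^ padicValNat 2 p := by
  obtain ⟨t, ht⟩ := two_pow_padicValNat_dvd_intCast p
  have hodd : ¬ 2 ∣ t := by
    rintro ⟨u, rfl⟩
    exact two_pow_succ_padicValNat_not_dvd_intCast hp ⟨u, by rw [pow_succ, mul_assoc]; exact ht⟩
  obtain ⟨u, hu⟩ : 2 ∣ t + 1 := by omega
  refine ⟨u, ?_⟩
  rw [pow_succ]
  linear_combination ht + 2 ^ padicValNat 2 p * hu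

/-- If the dyadic intervals centred at `p` and `q` meet and `ν(p) < ν(q)`, then the first one is
contained in the second. -/
theorem abs_sub_add_two_pow_padicValNat_le {p q : ℕ} {a : ℤ} (hp : p ≠ 0)
    (hpq : padicValNat 2 p < padicValNat 2 q)
    (hap : |a - p| < 2 ^ padicValNat 2 p) (haq : |a - q| < 2 ^ padicValNat 2 q) :
    |(p : ℤ) - q| + 2 ^ padicValNat 2 p ≤ 2 ^ padicValNat 2 q := by
  have hp2 := two_pow_padicValNat_dvd_intCast p
  have hn := two_pow_succ_padicValNat_not_dvd_intCast hp
  have hq2 : (2 : ℤ) ^ (padicValNat 2 p + 1) ∣ q :=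
    (pow_dvd_pow _ hpq).trans (two_pow_padicValNat_dvd_intCast q)
  have hd : (2 : ℤ) ^ (padicValNat 2 p + 1) ∣ 2 ^ padicValNat 2 q := pow_dvd_pow _ hpq
  have hpp : (2 : ℤ) ^ padicValNat 2 p ∣ 2 ^ (padicValNat 2 p + 1) := pow_dvd_pow _ (by omega)
  rw [abs_lt] at hap haq
  have key : ∀ x : ℤ, 2 ^ padicValNat 2 p ∣ x → x ≠ 0 → 0 < x + 2 ^ padicValNat 2 p →
      2 ^ padicValNat 2 p ≤ x := fun x hx h0 hpos => by
    have h1 := Int.le_of_dvd hpos (dvd_add_self_right.2 hx)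
    exact Int.le_of_dvd (by omega) hx
  have hleft := key (p - q + 2 ^ padicValNat 2 q)
    (dvd_add (dvd_sub hp2 (hpp.trans hq2)) (hpp.trans hd))
    (fun h => hn (by
      rw [show (p : ℤ) = q - 2 ^ padicValNat 2 q by linarith]
      exact dvd_sub hq2 hd)) (by linarith)
  have hright := key (q - p + 2 ^ padicValNat 2 q)
    (dvd_add (dvd_sub (hpp.trans hq2) hp2) (hpp.trans hd))
    (fun h => hn (by
      rw [show (p : ℤ) = q + 2 ^ padicValNat 2 q by linarith]
      exact dvd_add hq2 hd)) (by linarith)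
  rw [← le_sub_iff_add_le, abs_le]
  constructor <;> linarith

/-- Dyadic intervals of the same level which meet have the same centre. -/
theorem eq_of_abs_sub_lt_two_pow_padicValNat {p q : ℕ} {a : ℤ} (hp : p ≠ 0) (hq : q ≠ 0)
    (hpq : padicValNat 2 p = padicValNat 2 q)
    (hap : |a - p| < 2 ^ padicValNat 2 p) (haq : |a - q| < 2 ^ padicValNat 2 q) : p = q := by
  have hp2 := two_pow_succ_padicValNat_dvd_add hp
  have hq2 := two_pow_succ_padicValNat_dvd_add hq
  rw [← hpq] at haq hq2
  have hd : (2 : ℤ) ^ (padicValNat 2 p + 1) ∣ p - q := by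
    simpa using dvd_sub hp2 hq2
  have h0 : (p : ℤ) - q = 0 := by
    refine Int.eq_zero_of_abs_lt_dvd hd ?_
    rw [abs_lt] at hap haq ⊢
    rw [pow_succ]
    constructor <;> linarith
  omega

/-- `p` lies in the dyadic interval centred at `q`. -/
def DyadicLE (p q : ℕ) : Prop :=
  |(p : ℤ) - q| < 2 ^ padicValNat 2 q

theorem DyadicLE.refl (p : ℕ) : DyadicLE p p := by
  simp [DyadicLE]

theorem DyadicLE.of_lt {p q : ℕ} {a : ℤ} (hp : p ≠ 0) (hpq : padicValNat 2 p < padicValNat 2 q)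
    (hap : |a - p| < 2 ^ padicValNat 2 p) (haq : |a - q| < 2 ^ padicValNat 2 q) :
    DyadicLE p q := by
  have h := abs_sub_add_two_pow_padicValNat_le hp hpq hap haq
  have hpos : (0 : ℤ) < 2 ^ padicValNat 2 p := by positivity
  unfold DyadicLE
  linarith

theorem DyadicLE.trans {a p q : ℕ} (hp : p ≠ 0) (hap : DyadicLE a p)
    (hpq : DyadicLE p q) : DyadicLE a q := by
  rcases lt_or_ge (padicValNat 2 p) (padicValNat 2 q) with h | h
  · have h1 := abs_sub_add_two_pow_padicValNat_le hp h (DyadicLE.refl p) hpq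
    have h2 := abs_sub_le (a : ℤ) p q
    unfold DyadicLE at *
    linarith
  · have h0 : (p : ℤ) - q = 0 := Int.eq_zero_of_abs_lt_dvd (dvd_sub
      ((pow_dvd_pow _ h).trans (two_pow_padicValNat_dvd_intCast p))
      (two_pow_padicValNat_dvd_intCast q)) hpq
    rwa [← show p = q by omega]

theorem DyadicLE.comparable {a p q : ℕ} (hp : p ≠ 0) (hq : q ≠ 0) (hap : DyadicLE a p)
    (haq : DyadicLE a q) : DyadicLE p q ∨ DyadicLE q p := by
  rcases lt_trichotomy (padicValNat 2 p) (padicValNat 2 q) with h | h | h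
  · exact .inl (.of_lt hp h hap haq)
  · rw [eq_of_abs_sub_lt_two_pow_padicValNat hp hq h hap haq]
    exact .inl (.refl q)
  · exact .inr (.of_lt hq h haq hap)

/-- The preorder on `ι` obtained by comparing positive integer labels by `DyadicLE`. -/
abbrev dyadicPreorder {ι : Type*} (f : ι → ℕ) (hf : ∀ i, f i ≠ 0) : Preorder ι where
  le i j := DyadicLE (f i) (f j)
  lt i j := DyadicLE (f i) (f j) ∧ ¬ DyadicLE (f j) (f i)
  le_refl _ := .refl _
  le_trans _ j _ := .trans (hf j)

theorem dyadIdx_blk_iff {N k : ℕ} (i j : Fin (k * (2 ^ N - 1))) :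
    dyadIdx N (blk k j) (blk k i) ↔ DyadicLE (blk k i) (blk k j) := by
  have hle : ∀ i : Fin (k * (2 ^ N - 1)), 1 ≤ blk k i ∧ blk k i ≤ 2 ^ N - 1 := fun i =>
    ⟨Nat.succ_pos _, Nat.div_lt_of_lt_mul i.isLt⟩
  simp [dyadIdx, DyadicLE, hle]

/-- For a symmetric positive definite symmetrically dyadic matrix `Σ` there are
vertically dyadic matrices `R` and `P` with `Σ = Rᵀ R` and `Σ⁻¹ = P Pᵀ`. -/
theorem dyadic_cholesky_and_inverse (N k : ℕ) (hN : 1 ≤ N) (hk : 1 ≤ k)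
    (Sig : Matrix (Fin (k * (2 ^ N - 1))) (Fin (k * (2 ^ N - 1))) ℝ)
    (hPD : Sig.PosDef) (hSD : IsSD N k Sig) :
    (∃ R : Matrix (Fin (k * (2 ^ N - 1))) (Fin (k * (2 ^ N - 1))) ℝ,
      IsVD N k R ∧ Sig = R.transpose * R) ∧
    (∃ P : Matrix (Fin (k * (2 ^ N - 1))) (Fin (k * (2 ^ N - 1))) ℝ,
      IsVD N k P ∧ Sig⁻¹ = P * P.transpose) := by
  simp only [IsSD, IsVD, dyadIdx_blk_iff] at hSD ⊢
  exact @Matrix.PosDef.exists_comparable_factorization _ _ _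
    (dyadicPreorder (fun i : Fin (k * (2 ^ N - 1)) => blk k i) fun _ => Nat.succ_ne_zero _)
    (fun _ _ _ => DyadicLE.comparable (Nat.succ_ne_zero _) (Nat.succ_ne_zero _))
    Sig hPD (fun i j h => hSD i j fun h' => h h'.symm)
end

section
/- Let d ≥ 1, let Σ be a d×d symmetric matrix with entries in {0,1} such that every neighborhood D_i = {j ∈ {1,…,d} : Σ_{ij} = 1} is nonempty, let π be a permutation of {1,…,d}, and set l_i = max{|π(i) − π(j)| : j ∈ D_i}. Suppose i and j are two distinct indices in {1,…,d} satisfying |l_i − l_j| ≤ |π(i) − π(j)| ≤ l_i + l_j. Then |2·|π(i) − π(j)| − |D_i Δ D_j|| ≤ (2·l_i + 1 − |D_i|) + (2·l_j + 1 − |D_j|), where Δ denotes symmetric difference and |·| denotes cardinality of a finite set. -/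
open scoped symmDiff

/-- The neighborhood `D_i = {j : Σ_{ij} = 1}` of the row index `i`. -/
def nbhd {d : ℕ} (S : Matrix (Fin d) (Fin d) ℕ) (i : Fin d) : Finset (Fin d) :=
  Finset.univ.filter fun j => S i j = 1

/-- The 1-based position of `i` under the permutation `π`, as an integer. -/
def posIdx {d : ℕ} (π : Equiv.Perm (Fin d)) (i : Fin d) : ℤ := (π i).val + 1

/-- The half-width `l_i^{(π)} = max_{j ∈ D_i} |π(i) - π(j)|` of `D_i` under `π`. -/
def halfWidth {d : ℕ} (S : Matrix (Fin d) (Fin d) ℕ) (π : Equiv.Perm (Fin d)) (i : Fin d) : ℕ :=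
  (nbhd S i).sup fun j => (posIdx π i - posIdx π j).natAbs

theorem posIdx_injective {d : ℕ} (π : Equiv.Perm (Fin d)) : Function.Injective (posIdx π) := by
  intro a b hab
  refine π.injective (Fin.ext ?_)
  unfold posIdx at hab
  omega

/-- Neighbors of `i` lie within distance `halfWidth S π i` of `i`. -/
theorem abs_posIdx_sub_le_halfWidth {d : ℕ} {S : Matrix (Fin d) (Fin d) ℕ}
    (π : Equiv.Perm (Fin d)) {i k : Fin d} (hk : k ∈ nbhd S i) :
    |posIdx π i - posIdx π k| ≤ (halfWidth S π i : ℤ) := by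
  have h : (posIdx π i - posIdx π k).natAbs ≤ halfWidth S π i :=
    Finset.le_sup (f := fun k => (posIdx π i - posIdx π k).natAbs) hk
  rw [Int.abs_eq_natAbs]
  exact_mod_cast h

/-- A set whose positions lie in `[a, b]` has at most as many elements as this interval. -/
theorem card_le_of_posIdx_mem_Icc {d : ℕ} (π : Equiv.Perm (Fin d)) {s : Finset (Fin d)} {a b : ℤ}
    (hab : a ≤ b + 1) (h : ∀ k ∈ s, a ≤ posIdx π k ∧ posIdx π k ≤ b) :
    (s.card : ℤ) ≤ b + 1 - a := by
  have hcard : s.card ≤ (Finset.Icc a b).card :=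
    Finset.card_le_card_of_injOn (posIdx π)
      (fun k hk => Finset.mem_coe.2 (Finset.mem_Icc.2 (h k hk))) (posIdx_injective π).injOn
  rw [Int.card_Icc] at hcard
  omega

theorem Finset.card_symmDiff_add_two_mul_card_inter {α : Type*} [DecidableEq α] (s t : Finset α) :
    (s ∆ t).card + 2 * (s ∩ t).card = s.card + t.card := by
  have hdisj : Disjoint (s \ t) (t \ s) := disjoint_sdiff_sdiff
  have hs := Finset.card_sdiff_add_card_inter s t
  have ht := Finset.card_sdiff_add_card_inter t s
  rw [Finset.inter_comm t s] at ht
  have h : (s ∆ t).card = (s \ t).card + (t \ s).card := Finset.card_union_of_disjoint hdisj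
  omega

/-- Theorem bounding the distance-matrix approximation error for a single pair of indices:
`|2|π(i) - π(j)| - |D_i Δ D_j|| ≤ (2l_i + 1 - |D_i|) + (2l_j + 1 - |D_j|)`. -/
theorem approx_error_bound (d : ℕ) (hd : 1 ≤ d) (S : Matrix (Fin d) (Fin d) ℕ)
    (h01 : ∀ i j, S i j = 0 ∨ S i j = 1) (hsym : ∀ i j, S i j = S j i)
    (hne : ∀ i, (nbhd S i).Nonempty) (π : Equiv.Perm (Fin d))
    (i j : Fin d) (hij : i ≠ j)
    (hlow : |(halfWidth S π i : ℤ) - (halfWidth S π j : ℤ)| ≤ |posIdx π i - posIdx π j|)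
    (hup : |posIdx π i - posIdx π j| ≤ (halfWidth S π i : ℤ) + (halfWidth S π j : ℤ)) :
    |2 * |posIdx π i - posIdx π j| - ((nbhd S i ∆ nbhd S j).card : ℤ)| ≤
      (2 * (halfWidth S π i : ℤ) + 1 - ((nbhd S i).card : ℤ)) +
      (2 * (halfWidth S π j : ℤ) + 1 - ((nbhd S j).card : ℤ)) := by
  have hsymm := Finset.card_symmDiff_add_two_mul_card_inter (nbhd S i) (nbhd S j)
  have hunion := Finset.card_union_add_card_inter (nbhd S i) (nbhd S j)
  have hi : ∀ k ∈ nbhd S i, _ := fun k hk => abs_le.1 (abs_posIdx_sub_le_halfWidth π hk)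
  have hj : ∀ k ∈ nbhd S j, _ := fun k hk => abs_le.1 (abs_posIdx_sub_le_halfWidth π hk)
  have hlow' := abs_le.1 hlow
  -- The intersection and the union are contained in those of the two enclosing intervals.
  have hinter_le : ((nbhd S i ∩ nbhd S j).card : ℤ) ≤
      halfWidth S π i + halfWidth S π j + 1 - |posIdx π i - posIdx π j| := by
    rcases le_total (posIdx π i) (posIdx π j) with hle | hle
    · have habs := abs_of_nonpos (sub_nonpos.2 hle)
      have := card_le_of_posIdx_mem_Icc π (s := nbhd S i ∩ nbhd S j)
        (a := posIdx π j - halfWidth S π j) (b := posIdx π i + halfWidth S π i) (by omega)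
        fun k hk => by
          have h₁ := hi k (Finset.mem_inter.1 hk).1
          have h₂ := hj k (Finset.mem_inter.1 hk).2
          omega
      omega
    · have habs := abs_of_nonneg (sub_nonneg.2 hle)
      have := card_le_of_posIdx_mem_Icc π (s := nbhd S i ∩ nbhd S j)
        (a := posIdx π i - halfWidth S π i) (b := posIdx π j + halfWidth S π j) (by omega)
        fun k hk => by
          have h₁ := hi k (Finset.mem_inter.1 hk).1
          have h₂ := hj k (Finset.mem_inter.1 hk).2
          omega
      omega
  have hunion_le : ((nbhd S i ∪ nbhd S j).card : ℤ) ≤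
      halfWidth S π i + halfWidth S π j + 1 + |posIdx π i - posIdx π j| := by
    rcases le_total (posIdx π i) (posIdx π j) with hle | hle
    · have habs := abs_of_nonpos (sub_nonpos.2 hle)
      have := card_le_of_posIdx_mem_Icc π (s := nbhd S i ∪ nbhd S j)
        (a := posIdx π i - halfWidth S π i) (b := posIdx π j + halfWidth S π j) (by omega)
        fun k hk => by
          rcases Finset.mem_union.1 hk with h | h
          · have := hi k h
            omega
          · have := hj k h
            omega
      omega
    · have habs := abs_of_nonneg (sub_nonneg.2 hle)
      have := card_le_of_posIdx_mem_Icc π (s := nbhd S i ∪ nbhd S j)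
        (a := posIdx π j - halfWidth S π j) (b := posIdx π i + halfWidth S π i) (by omega)
        fun k hk => by
          rcases Finset.mem_union.1 hk with h | h
          · have := hi k h
            omega
          · have := hj k h
            omega
      omega
  rw [abs_le]
  constructor <;> omega
end

section
/- Let d ≥ 1, let Σ be a d×d symmetric matrix with entries in {0,1} such that every neighborhood D_i = {j ∈ {1,…,d} : Σ_{ij} = 1} is nonempty, let π be a permutation of {1,…,d}, and set l_i = max{|π(i) − π(j)| : j ∈ D_i}. Suppose that for every pair of distinct indices i, j ∈ {1,…,d} the inequalities |l_i − l_j| ≤ |π(i) − π(j)| ≤ l_i + l_j hold. Then Σ_{i≠j} |2·|π(i) − π(j)| − |D_i Δ D_j|| ≤ 4·(d−1)·Σ_{i=1}^d l_i + Σ_{i≠j} (2 − |D_i| − |D_j|), where both sums over i ≠ j range over all ordered pairs of distinct indices in {1,…,d}, Δ denotes symmetric difference, and the inequality is between integers (equivalently, real numbers). -/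
open scoped symmDiff

/-- The cardinality of a symmetric difference by inclusion-exclusion, over the integers. -/
theorem card_symmDiff_int {α : Type*} [DecidableEq α] (A B : Finset α) :
    ((A ∆ B).card : ℤ) = A.card + B.card - 2 * (A ∩ B).card := by
  have h1 : (A ∆ B).card = (A \ B).card + (B \ A).card := by
    rw [symmDiff_def, Finset.sup_eq_union, Finset.card_union_of_disjoint disjoint_sdiff_sdiff]
  have h2 := Finset.card_sdiff_add_card_inter A B
  have h3 := Finset.card_sdiff_add_card_inter B A
  rw [Finset.inter_comm B A] at h3
  omega

/-- Shrinking two sets changes the size of their symmetric difference by at most the number of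
removed elements. -/
theorem abs_card_symmDiff_sub_le {α : Type*} [DecidableEq α] {A B A' B' : Finset α}
    (h : A ⊆ B) (h' : A' ⊆ B') :
    |((B ∆ B').card : ℤ) - (A ∆ A').card| ≤
      ((B.card : ℤ) - A.card) + ((B'.card : ℤ) - A'.card) := by
  have h1 : (A ∩ A').card ≤ (B ∩ B').card :=
    Finset.card_le_card (Finset.inter_subset_inter h h')
  have h2 : (B ∩ B').card ≤ ((A ∩ A') ∪ ((B \ A) ∪ (B' \ A'))).card := by
    apply Finset.card_le_card
    intro x hx
    simp only [Finset.mem_inter, Finset.mem_union, Finset.mem_sdiff] at hx ⊢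
    tauto
  have h3 := Finset.card_union_le (A ∩ A') ((B \ A) ∪ (B' \ A'))
  have h4 := Finset.card_union_le (B \ A) (B' \ A')
  have h5 := Finset.card_sdiff_add_card_eq_card h
  have h6 := Finset.card_sdiff_add_card_eq_card h'
  rw [card_symmDiff_int, card_symmDiff_int, abs_le]
  constructor <;> omega

/-- Two overlapping, non-nested integer intervals with centers `p`, `q` have a symmetric
difference of size `2|p - q|`. -/
theorem card_symmDiff_Icc (p q : ℤ) (a b : ℕ) (h1 : |(a : ℤ) - b| ≤ |p - q|)
    (h2 : |p - q| ≤ a + b) :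
    ((Finset.Icc (p - a) (p + a) ∆ Finset.Icc (q - b) (q + b)).card : ℤ) = 2 * |p - q| := by
  have hinter : Finset.Icc (p - a) (p + a) ∩ Finset.Icc (q - b) (q + b) =
      Finset.Icc (max (p - a) (q - b)) (min (p + a) (q + b)) := by
    ext x
    simp only [Finset.mem_inter, Finset.mem_Icc]
    omega
  rw [card_symmDiff_int, hinter, Int.card_Icc, Int.card_Icc, Int.card_Icc]
  grind

theorem image_nbhd_subset_Icc {d : ℕ} (S : Matrix (Fin d) (Fin d) ℕ) (π : Equiv.Perm (Fin d))
    (i : Fin d) :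
    (nbhd S i).image (posIdx π) ⊆
      Finset.Icc (posIdx π i - halfWidth S π i) (posIdx π i + halfWidth S π i) := by
  intro x hx
  obtain ⟨j, hj, rfl⟩ := Finset.mem_image.1 hx
  have h : (posIdx π i - posIdx π j).natAbs ≤ halfWidth S π i :=
    Finset.le_sup (f := fun j => (posIdx π i - posIdx π j).natAbs) hj
  rw [Finset.mem_Icc]
  omega

/-- The approximation bound for a single pair of indices. -/
theorem approx_error_le {d : ℕ} (S : Matrix (Fin d) (Fin d) ℕ) (π : Equiv.Perm (Fin d))
    (i j : Fin d)
    (h1 : |(halfWidth S π i : ℤ) - (halfWidth S π j : ℤ)| ≤ |posIdx π i - posIdx π j|)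
    (h2 : |posIdx π i - posIdx π j| ≤ (halfWidth S π i : ℤ) + (halfWidth S π j : ℤ)) :
    |2 * |posIdx π i - posIdx π j| - ((nbhd S i ∆ nbhd S j).card : ℤ)| ≤
      2 * ((halfWidth S π i : ℤ) + halfWidth S π j) +
        (2 - ((nbhd S i).card : ℤ) - ((nbhd S j).card : ℤ)) := by
  have h := abs_card_symmDiff_sub_le (image_nbhd_subset_Icc S π i) (image_nbhd_subset_Icc S π j)
  rw [card_symmDiff_Icc _ _ _ _ h1 h2, ← Finset.image_symmDiff _ _ (posIdx_injective π),
    Finset.card_image_of_injective _ (posIdx_injective π),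
    Finset.card_image_of_injective _ (posIdx_injective π),
    Finset.card_image_of_injective _ (posIdx_injective π), Int.card_Icc, Int.card_Icc] at h
  omega

theorem sum_sum_sdiff_singleton_add {d : ℕ} (l : Fin d → ℤ) :
    ∑ i : Fin d, ∑ j ∈ Finset.univ \ {i}, 2 * (l i + l j) = 4 * ((d : ℤ) - 1) * ∑ i, l i := by
  have h (i : Fin d) : ∑ j ∈ Finset.univ \ {i}, 2 * (l i + l j) =
      2 * (d : ℤ) * l i + 2 * ∑ j, l j - 4 * l i := by
    rw [eq_sub_iff_add_eq, ← Finset.sum_sdiff (Finset.subset_univ {i}) (f := l),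
      ← Finset.mul_sum, Finset.sum_add_distrib, Finset.sum_const, Finset.sum_singleton,
      Finset.card_sdiff_of_subset (Finset.subset_univ _), Finset.card_univ, Fintype.card_fin,
      Finset.card_singleton, nsmul_eq_mul, Nat.cast_sub (by have := i.pos; omega)]
    push_cast
    ring
  simp only [h, Finset.sum_sub_distrib, Finset.sum_add_distrib, ← Finset.mul_sum,
    Finset.sum_const, Finset.card_univ, Fintype.card_fin, nsmul_eq_mul]
  ring

/-- Summed approximation bound:
`Σ_{i≠j} |2|π(i)-π(j)| - |D_i Δ D_j|| ≤ 4(d-1)·Σ_i l_i + Σ_{i≠j} (2 - |D_i| - |D_j|)`. -/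
theorem approx_error_sum_bound (d : ℕ) (hd : 1 ≤ d) (S : Matrix (Fin d) (Fin d) ℕ)
    (h01 : ∀ i j, S i j = 0 ∨ S i j = 1) (hsym : ∀ i j, S i j = S j i)
    (hne : ∀ i, (nbhd S i).Nonempty) (π : Equiv.Perm (Fin d))
    (hineq : ∀ i j : Fin d, i ≠ j →
      |(halfWidth S π i : ℤ) - (halfWidth S π j : ℤ)| ≤ |posIdx π i - posIdx π j| ∧
      |posIdx π i - posIdx π j| ≤ (halfWidth S π i : ℤ) + (halfWidth S π j : ℤ)) :
    ∑ i : Fin d, ∑ j ∈ Finset.univ \ {i},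
        |2 * |posIdx π i - posIdx π j| - ((nbhd S i ∆ nbhd S j).card : ℤ)| ≤
      4 * ((d : ℤ) - 1) * ∑ i : Fin d, (halfWidth S π i : ℤ) +
      ∑ i : Fin d, ∑ j ∈ Finset.univ \ {i},
        (2 - ((nbhd S i).card : ℤ) - ((nbhd S j).card : ℤ)) := by
  rw [← sum_sum_sdiff_singleton_add, ← Finset.sum_add_distrib]
  refine Finset.sum_le_sum fun i _ => ?_
  rw [← Finset.sum_add_distrib]
  refine Finset.sum_le_sum fun j hj => ?_
  have hij : i ≠ j := by
    rintro rfl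
    simp at hj
  exact approx_error_le S π i j (hineq i j hij).1 (hineq i j hij).2
end

section
/- Let d ≥ 1 and let Σ be a d×d symmetric matrix with entries in {0,1} with Σ_{ii} = 1 for all i ∈ {1,…,d}. Suppose there exist a permutation π of {1,…,d} and an integer λ ≥ 0 such that for all i, j ∈ {1,…,d}: Σ_{ij} = 1 if and only if |π(i) − π(j)| ≤ λ (that is, π packs Σ into a full band matrix with half-bandwidth λ). Then π minimizes the half-width of Σ: for every permutation σ of {1,…,d}, Σ_{i=1}^d l_i^{(π)} ≤ Σ_{i=1}^d l_i^{(σ)}. -/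
open scoped symmDiff

/-- The number of positions within distance `k` of the position of `i`. -/
theorem card_posIdx_natAbs_sub_le {d : ℕ} (π : Equiv.Perm (Fin d)) (i : Fin d) (k : ℕ) :
    (Finset.univ.filter fun j => (posIdx π i - posIdx π j).natAbs ≤ k).card =
      min k (π i).val + min k (d - 1 - (π i).val) + 1 := by
  have hi := (π i).isLt
  have hmap : ((Finset.univ.filter fun j => (posIdx π i - posIdx π j).natAbs ≤ k).map
      (π.toEmbedding.trans Fin.valEmbedding)) =
      Finset.Icc ((π i).val - k) (min (d - 1) ((π i).val + k)) := by
    ext x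
    simp only [Finset.mem_map, Finset.mem_filter, Finset.mem_univ, true_and, Finset.mem_Icc,
      Function.Embedding.trans_apply, Equiv.coe_toEmbedding, Fin.valEmbedding_apply]
    constructor
    · rintro ⟨j, hj, rfl⟩
      rw [posIdx, posIdx] at hj
      have := (π j).isLt
      omega
    · intro hx
      refine ⟨π.symm ⟨x, by omega⟩, ?_, ?_⟩ <;> simp only [posIdx, Equiv.apply_symm_apply]
      omega
  rw [← Finset.card_map, hmap, Nat.card_Icc]
  omega

/-- A neighborhood fits into the window of radius `halfWidth` around its center. -/
theorem card_nbhd_le {d : ℕ} (S : Matrix (Fin d) (Fin d) ℕ) (σ : Equiv.Perm (Fin d))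
    (i : Fin d) :
    (nbhd S i).card ≤ min (halfWidth S σ i) (σ i).val +
      min (halfWidth S σ i) (d - 1 - (σ i).val) + 1 := by
  rw [← card_posIdx_natAbs_sub_le]
  refine Finset.card_le_card fun j hj => ?_
  exact Finset.mem_filter.2 ⟨Finset.mem_univ j,
    Finset.le_sup (f := fun j => (posIdx σ i - posIdx σ j).natAbs) hj⟩

/-- In a packed full band matrix, the half-width of `i` is at most `lam` and at most the distance
from the position of `i` to the farther end. -/
theorem halfWidth_le_of_band {d : ℕ} {S : Matrix (Fin d) (Fin d) ℕ} {π : Equiv.Perm (Fin d)}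
    {lam : ℕ} (hband : ∀ i j, S i j = 1 ↔ (posIdx π i - posIdx π j).natAbs ≤ lam) (i : Fin d) :
    halfWidth S π i ≤ min lam (max (π i).val (d - 1 - (π i).val)) := by
  refine Finset.sup_le fun j hj => ?_
  have hj' := (hband i j).1 (Finset.mem_filter.1 hj).2
  have hi := (π i).isLt
  have := (π j).isLt
  simp only [posIdx] at hj' ⊢
  omega

/-- In a packed full band matrix, half-widths under `π` and any `σ` compare up to the distances,
capped at `lam`, from the position of `i` to the nearer end. -/
theorem halfWidth_add_le_of_band {d : ℕ} {S : Matrix (Fin d) (Fin d) ℕ}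
    {π : Equiv.Perm (Fin d)} {lam : ℕ}
    (hband : ∀ i j, S i j = 1 ↔ (posIdx π i - posIdx π j).natAbs ≤ lam)
    (σ : Equiv.Perm (Fin d)) (i : Fin d) :
    halfWidth S π i + min lam (min (π i).val (d - 1 - (π i).val)) ≤
      halfWidth S σ i + min lam (min (σ i).val (d - 1 - (σ i).val)) := by
  have hπ := halfWidth_le_of_band hband i
  have hcard : (nbhd S i).card = min lam (π i).val + min lam (d - 1 - (π i).val) + 1 := by
    rw [← card_posIdx_natAbs_sub_le, nbhd]
    simp only [hband]
  have hσ := card_nbhd_le S σ i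
  omega

/-- If a permutation `π` packs the symmetric 0–1 matrix `Σ` into a full band matrix with
half-bandwidth `λ`, then `π` minimizes the half-width `Σ_i l_i^{(·)}` of `Σ`. -/
theorem full_band_packing_optimal (d : ℕ) (hd : 1 ≤ d) (S : Matrix (Fin d) (Fin d) ℕ)
    (h01 : ∀ i j, S i j = 0 ∨ S i j = 1) (hsym : ∀ i j, S i j = S j i)
    (hdiag : ∀ i, S i i = 1) (π : Equiv.Perm (Fin d)) (lam : ℕ)
    (hband : ∀ i j, S i j = 1 ↔ (posIdx π i - posIdx π j).natAbs ≤ lam) :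
    ∀ σ : Equiv.Perm (Fin d),
      ∑ i : Fin d, halfWidth S π i ≤ ∑ i : Fin d, halfWidth S σ i := by
  intro σ
  let g : Fin d → ℕ := fun p => min lam (min p.val (d - 1 - p.val))
  have h : ∑ i, (halfWidth S π i + g (π i)) ≤ ∑ i, (halfWidth S σ i + g (σ i)) :=
    Finset.sum_le_sum fun i _ => halfWidth_add_le_of_band hband σ i
  rw [Finset.sum_add_distrib, Finset.sum_add_distrib, Equiv.sum_comp π g, Equiv.sum_comp σ g] at h
  exact Nat.le_of_add_le_add_right h
end

section
/- Let d and μ be integers with μ ≥ 1 and 2·μ + 1 ≤ d, and let π be a permutation of {1,…,d} such that for all i, j ∈ {1,…,d}: |π(i) − π(j)| ≤ μ if and only if |i − j| ≤ μ. Then either π is the identity permutation, or π is the reversal permutation, i.e. π(i) = d + 1 − i for all i ∈ {1,…,d}. Equivalently, when 2μ + 1 ≤ d, the only permutations that map a full band 0–1 matrix with half-bandwidth μ to a full band matrix with half-bandwidth μ (by simultaneously permuting rows and columns) are the identity and the reversal. -/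
/-- The `i`-th row of the full band matrix of half-bandwidth `mu`, as a set of column indices. -/
def bandRow (d mu : ℕ) (i : Fin d) : Finset (Fin d) :=
  Finset.univ.filter fun j => ((i.val : ℤ) - (j.val : ℤ)).natAbs ≤ mu

theorem card_bandRow (d mu : ℕ) (i : Fin d) :
    (bandRow d mu i).card = min (i.val + mu + 1) d - (i.val - mu) := by
  rw [← Nat.card_Ico, ← Finset.card_map Fin.valEmbedding]
  congr 1
  ext x
  simp only [bandRow, Finset.mem_map, Finset.mem_filter, Finset.mem_univ, true_and,
    Fin.valEmbedding_apply, Finset.mem_Ico]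
  constructor
  · rintro ⟨j, hj, rfl⟩
    have := j.isLt
    omega
  · intro hx
    exact ⟨⟨x, by omega⟩, by simp only; omega, rfl⟩

theorem card_bandRow_apply_perm {d mu : ℕ} (π : Equiv.Perm (Fin d))
    (h : ∀ i j : Fin d,
      (((π i).val : ℤ) - ((π j).val : ℤ)).natAbs ≤ mu ↔
        ((i.val : ℤ) - (j.val : ℤ)).natAbs ≤ mu) (i : Fin d) :
    (bandRow d mu (π i)).card = (bandRow d mu i).card :=
  (Finset.card_equiv π fun j => by simp [bandRow, h i j]).symm

/-- Near the ends of the index range, the row sizes determine the index up to reversal. -/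
theorem band_perm_apply_eq_or_rev {d mu : ℕ} (hd : 2 * mu + 1 ≤ d) (π : Equiv.Perm (Fin d))
    (h : ∀ i j : Fin d,
      (((π i).val : ℤ) - ((π j).val : ℤ)).natAbs ≤ mu ↔
        ((i.val : ℤ) - (j.val : ℤ)).natAbs ≤ mu) (i : Fin d) (hi : i.val < mu) :
    (π i).val = i.val ∨ (π i).val + i.val + 1 = d := by
  have hcard := card_bandRow_apply_perm π h i
  rw [card_bandRow, card_bandRow] at hcard
  have := (π i).isLt
  omega

theorem band_perm_eq_self_of_zero {d mu : ℕ} (hmu : 1 ≤ mu) (hd : 2 * mu + 1 ≤ d)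
    (π : Equiv.Perm (Fin d))
    (h : ∀ i j : Fin d,
      (((π i).val : ℤ) - ((π j).val : ℤ)).natAbs ≤ mu ↔
        ((i.val : ℤ) - (j.val : ℤ)).natAbs ≤ mu)
    (hzero : ∀ i : Fin d, i.val = 0 → (π i).val = 0) (i : Fin d) : π i = i := by
  obtain ⟨k, hk⟩ := i
  induction k using Nat.strong_induction_on with
  | _ k ih =>
    rw [Fin.ext_iff]
    by_cases hkmu : k < mu
    · have hadj := (h ⟨k, hk⟩ ⟨0, by omega⟩).2 (by simp only; omega)
      rw [hzero ⟨0, by omega⟩ rfl] at hadj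
      have := band_perm_apply_eq_or_rev hd π h ⟨k, hk⟩ hkmu
      simp only at this ⊢
      omega
    · have hadj := (h ⟨k, hk⟩ ⟨k - mu, by omega⟩).2 (by simp only; omega)
      rw [ih (k - mu) (by omega)] at hadj
      have hge : ¬ (π ⟨k, hk⟩).val < k := fun hlt => by
        have heq := π.injective (ih _ hlt (π ⟨k, hk⟩).isLt)
        have := congrArg Fin.val heq
        simp only at this
        omega
      simp only at hadj ⊢
      omega

/-- When `2μ + 1 ≤ d`, the only permutations preserving the full band structure with
half-bandwidth `μ` (i.e. `|π(i) - π(j)| ≤ μ ↔ |i - j| ≤ μ`) are the identity and the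
reversal `π(i) = d + 1 - i` (0-based: `π(i) = d - 1 - i`). -/
theorem band_preserving_perm (d mu : ℕ) (hmu : 1 ≤ mu) (hd : 2 * mu + 1 ≤ d)
    (π : Equiv.Perm (Fin d))
    (h : ∀ i j : Fin d,
      (((π i).val : ℤ) - ((π j).val : ℤ)).natAbs ≤ mu ↔
        ((i.val : ℤ) - (j.val : ℤ)).natAbs ≤ mu) :
    (∀ i, π i = i) ∨ (∀ i : Fin d, ((π i).val : ℤ) = (d : ℤ) - 1 - (i.val : ℤ)) := by
  rcases band_perm_apply_eq_or_rev hd π h ⟨0, by omega⟩ hmu with h0 | h0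
  · refine Or.inl (band_perm_eq_self_of_zero hmu hd π h fun i hi => ?_)
    rwa [show i = ⟨0, by omega⟩ from Fin.ext hi]
  · right
    have hrev := band_perm_eq_self_of_zero hmu hd (π.trans Fin.revPerm) (fun i j => by
      rw [← h i j]
      simp only [Equiv.trans_apply, Fin.revPerm_apply, Fin.val_rev]
      have := (π i).isLt
      have := (π j).isLt
      omega) (fun i hi => by
        rw [show i = ⟨0, by omega⟩ from Fin.ext hi]
        simp only [Equiv.trans_apply, Fin.revPerm_apply, Fin.val_rev]
        simp only at h0
        omega)
    intro i
    have := congrArg Fin.val (hrev i)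
    simp only [Equiv.trans_apply, Fin.revPerm_apply, Fin.val_rev] at this
    have := (π i).isLt
    omega
end
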